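/- Let ω ≥ 3 be an integer and let ε, c > 0 be real constants. Let G be a finite simple graph with m edges and clique number ω(G) = ω such that t(G) ≤ c·m^(1.5−ε). If m ≥ (10.06·c·√ω)^(1/ε), then s_ℓ(G) ≤ 2m·(1 − 1/ω), where ℓ = min{n⁺, ω}. -/

import Mathlib

/-- The adjacency matrix of a simple graph over `ℝ` is Hermitian (symmetric). -/
lemma adjMatrix_isHermitian {V : Type*} [Fintype V] (G : SimpleGraph V)
    [DecidableRel G.Adj] : (G.adjMatrix ℝ).IsHermitian := by
  rw [Matrix.IsHermitian, Matrix.conjTranspose_eq_transpose_of_trivial]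
  exact G.isSymm_adjMatrix

lemma aux_trace_pow {V : Type*} [Fintype V] [DecidableEq V] (A : Matrix V V ℝ)
    (hA : A.IsHermitian) (k : ℕ) : (A ^ k).trace = ∑ v, hA.eigenvalues v ^ k := by
  conv_lhs => rw [hA.spectral_theorem, ← map_pow, Unitary.conjStarAlgAut_apply,
    Matrix.trace_mul_comm, ← mul_assoc]
  simp [Matrix.diagonal_pow, Matrix.trace]

lemma aux_trace_sq {V : Type*} [Fintype V] [DecidableEq V] (G : SimpleGraph V)
    [DecidableRel G.Adj] : ((G.adjMatrix ℝ) ^ 2).trace = 2 * (G.edgeFinset.card : ℝ) := by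
  have h := G.sum_degrees_eq_twice_card_edges
  rw [pow_two, Matrix.trace]
  simp only [Matrix.diag_apply, SimpleGraph.adjMatrix_mul_self_apply_self]
  exact_mod_cast h

lemma aux_trace_cube {V : Type*} [Fintype V] [DecidableEq V] (G : SimpleGraph V)
    [DecidableRel G.Adj] :
    ((G.adjMatrix ℝ) ^ 3).trace ≤ 6 * ((G.cliqueFinset 3).card : ℝ) := by
  have h1 : ((G.adjMatrix ℝ) ^ 3).trace =
      ((Finset.univ.filter (fun p : V × V × V =>
        G.Adj p.1 p.2.1 ∧ G.Adj p.2.1 p.2.2 ∧ G.Adj p.2.2 p.1)).card : ℝ) := by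
    rw [pow_three, Matrix.trace, Finset.card_filter]
    simp only [Matrix.diag_apply, Matrix.mul_apply, SimpleGraph.adjMatrix_apply,
      Fintype.sum_prod_type, Finset.mul_sum]
    push_cast
    refine Finset.sum_congr rfl fun a _ => Finset.sum_congr rfl fun b _ =>
      Finset.sum_congr rfl fun c _ => ?_
    by_cases hab : G.Adj a b <;> by_cases hbc : G.Adj b c <;> by_cases hca : G.Adj c a <;>
      simp [hab, hbc, hca]
  rw [h1]
  have h2 := Finset.card_le_mul_card_image_of_maps_to
    (s := Finset.univ.filter (fun p : V × V × V =>
        G.Adj p.1 p.2.1 ∧ G.Adj p.2.1 p.2.2 ∧ G.Adj p.2.2 p.1))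
    (t := G.cliqueFinset 3) (f := fun p => {p.1, p.2.1, p.2.2}) ?_ 6 ?_
  · exact_mod_cast h2
  · rintro ⟨a, b, c⟩ h
    simp only [Finset.mem_filter, Finset.mem_univ, true_and] at h
    rw [SimpleGraph.mem_cliqueFinset_iff, SimpleGraph.is3Clique_iff]
    exact ⟨a, b, c, h.1, h.2.2.symm, h.2.1, rfl⟩
  · intro s hs
    rw [SimpleGraph.mem_cliqueFinset_iff, SimpleGraph.is3Clique_iff] at hs
    obtain ⟨x, y, z, hxy, hxz, hyz, rfl⟩ := hs
    have hsub : (Finset.univ.filter (fun p : V × V × V =>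
        G.Adj p.1 p.2.1 ∧ G.Adj p.2.1 p.2.2 ∧ G.Adj p.2.2 p.1)).filter
          (fun p => ({p.1, p.2.1, p.2.2} : Finset V) = {x, y, z}) ⊆
        {(x, y, z), (x, z, y), (y, x, z), (y, z, x), (z, x, y), (z, y, x)} := by
      rintro ⟨a, b, c⟩ h
      simp only [Finset.mem_filter, Finset.mem_univ, true_and] at h
      obtain ⟨⟨hab, hbc, hca⟩, he⟩ := h
      have ha : a ∈ ({x, y, z} : Finset V) := by rw [← he]; simp
      have hb : b ∈ ({x, y, z} : Finset V) := by rw [← he]; simp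
      have hc : c ∈ ({x, y, z} : Finset V) := by rw [← he]; simp
      have n1 := hab.ne
      have n2 := hbc.ne
      have n3 := hca.ne
      clear he hab hbc hca
      simp only [Finset.mem_insert, Finset.mem_singleton] at ha hb hc
      rcases ha with rfl | rfl | rfl <;> rcases hb with rfl | rfl | rfl <;>
        rcases hc with rfl | rfl | rfl <;> simp_all
    exact (Finset.card_le_card hsub).trans Finset.card_le_six

lemma aux_pos_cubes {ι : Type*} (S : Finset ι) (f : ι → ℝ) (hf : ∀ i ∈ S, 0 < f i)
    (w : ℝ) (hw : (S.card : ℝ) ≤ w) :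
    (∑ i ∈ S, f i ^ 2) ^ 3 ≤ w * (∑ i ∈ S, f i ^ 3) ^ 2 := by
  have h1 : (∑ i ∈ S, f i) ^ 2 ≤ S.card * ∑ i ∈ S, f i ^ 2 := sq_sum_le_card_mul_sum_sq
  have h2 : (∑ i ∈ S, f i ^ 2) ^ 2 ≤ (∑ i ∈ S, f i) * ∑ i ∈ S, f i ^ 3 := by
    refine Finset.sum_sq_le_sum_mul_sum_of_sq_le_mul S (fun i hi => (hf i hi).le)
      (fun i hi => (pow_pos (hf i hi) 3).le) (fun i hi => le_of_eq (by ring))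
  set a := ∑ i ∈ S, f i ^ 2
  set P := ∑ i ∈ S, f i ^ 3
  set L := ∑ i ∈ S, f i
  have ha : 0 ≤ a := Finset.sum_nonneg fun i _ => sq_nonneg _
  rcases ha.eq_or_lt with h0 | h0
  · rw [← h0, zero_pow three_ne_zero]
    have : 0 ≤ w := le_trans (Nat.cast_nonneg _) hw
    positivity
  · have h3 : a ^ 4 ≤ L ^ 2 * P ^ 2 := by
      calc a ^ 4 = (a ^ 2) ^ 2 := by ring
        _ ≤ (L * P) ^ 2 := by gcongr
        _ = _ := by ring
    have h4 : L ^ 2 * P ^ 2 ≤ (w * a) * P ^ 2 := by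
      gcongr
      exact h1.trans (by gcongr)
    refine le_of_mul_le_mul_left ?_ h0
    nlinarith

lemma aux_rest {ι : Type*} (R : Finset ι) (f : ι → ℝ) :
    -((∑ i ∈ R, f i ^ 2) * √(∑ i ∈ R, f i ^ 2)) ≤ ∑ i ∈ R, f i ^ 3 := by
  set b := ∑ i ∈ R, f i ^ 2 with hb
  have : ∀ i ∈ R, -(f i ^ 2 * √b) ≤ f i ^ 3 := by
    intro i hi
    have h1 : f i ^ 2 ≤ b := Finset.single_le_sum (f := fun i => f i ^ 2)
      (fun j _ => sq_nonneg _) hi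
    have h2 : |f i| ≤ √b := Real.abs_le_sqrt h1
    have h3 := neg_abs_le (f i)
    nlinarith [sq_nonneg (f i)]
  calc -(b * √b) = ∑ i ∈ R, -(f i ^ 2 * √b) := by
        rw [Finset.sum_neg_distrib, ← Finset.sum_mul]
    _ ≤ _ := Finset.sum_le_sum this

lemma aux_core (m w a b P Q t : ℝ) (hm : 0 < m) (hw : 3 ≤ w) (hab : a + b = 2 * m)
    (hb : 0 ≤ b) (hP : 0 ≤ P) (haP : a ^ 3 ≤ w * P ^ 2) (hQ : -(b * √b) ≤ Q)
    (hPQ : P + Q ≤ 6 * t) (ht : 10.06 * (t * √w) ≤ m * √m) :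
    a ≤ 2 * m * (1 - 1 / w) := by
  by_contra! hcon
  have hw0 : 0 < w := by linarith
  have hwb : w * b ≤ 2 * m := by
    have : b < 2 * m / w := by
      have : 2 * m * (1 - 1 / w) = 2 * m - 2 * m / w := by ring
      linarith
    rw [lt_div_iff₀ hw0] at this
    linarith
  have hb3 : b ≤ 2 * m / 3 := by nlinarith
  have ha3 : 4 * m / 3 ≤ a := by linarith
  have ha : 0 < a := by linarith
  obtain ⟨x, hx, rfl⟩ : ∃ x : ℝ, 0 < x ∧ m = x ^ 2 :=
    ⟨√m, Real.sqrt_pos.2 hm, (Real.sq_sqrt hm.le).symm⟩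
  rw [Real.sqrt_sq hx.le] at ht
  have h1 : a * √a ≤ √w * P := by
    refine abs_le_of_sq_le_sq' ?_ (by positivity) |>.2
    rw [mul_pow, mul_pow, Real.sq_sqrt ha.le, Real.sq_sqrt hw0.le]
    linarith
  have h2 : √w * √b ≤ 1.41422 * x := by
    rw [← Real.sqrt_mul hw0.le]
    apply Real.sqrt_le_iff.2 ⟨by positivity, by nlinarith⟩
  have h3 : 1.1547 * x ≤ √a := by
    apply Real.le_sqrt_of_sq_le; nlinarith
  have h4 : (4 * x ^ 2 / 3) * (1.1547 * x) ≤ a * √a := by gcongr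
  have h5 : b * (√w * √b) ≤ (2 * x ^ 2 / 3) * (1.41422 * x) := by gcongr
  have h6 : √w * (P - b * √b) ≤ √w * (6 * t) := by gcongr; linarith
  have h7 : 0 < x ^ 3 := by positivity
  nlinarith

/-- **Remark (edge lower bound).** Let `ω ≥ 3` be an integer and `ε, c > 0` reals. If `G`
has `m` edges, clique number `ω`, at most `c·m^(1.5−ε)` triangles, and
`m ≥ (10.06·c·√ω)^(1/ε)`, then `s_ℓ(G) ≤ 2m(1 − 1/ω)` where `ℓ = min{n⁺, ω}`,
`n⁺` is the number of positive eigenvalues and `s_ℓ` the sum of squares of the `ℓ`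
largest eigenvalues `μ 0 ≥ μ 1 ≥ ⋯`. -/
theorem stmt_1 {V : Type*} [Fintype V] [DecidableEq V]
    (G : SimpleGraph V) [DecidableRel G.Adj]
    (ω : ℕ) (hω : 3 ≤ ω) (hclique : G.cliqueNum = ω)
    (ε c : ℝ) (hε : 0 < ε) (hc : 0 < c)
    (m : ℕ) (hm : G.edgeFinset.card = m)
    (μ : Fin (Fintype.card V) → ℝ) (hanti : Antitone μ)
    (hμ : ∃ e : V ≃ Fin (Fintype.card V),
      ∀ v, (adjMatrix_isHermitian G).eigenvalues v = μ (e v))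
    (ht : ((G.cliqueFinset 3).card : ℝ) ≤ c * (m : ℝ) ^ (1.5 - ε))
    (hedges : (10.06 * c * Real.sqrt ω) ^ (1 / ε) ≤ (m : ℝ)) :
    (∑ i ∈ Finset.univ.filter
        (fun i : Fin (Fintype.card V) =>
          (i : ℕ) < min ((Finset.univ.filter fun j => 0 < μ j).card) ω),
        μ i ^ 2)
      ≤ 2 * (m : ℝ) * (1 - 1 / (ω : ℝ)) := by
  classical
  obtain ⟨e, he⟩ := hμ
  have hsq : ∑ i, μ i ^ 2 = 2 * (m : ℝ) := by
    rw [← hm, ← aux_trace_sq, aux_trace_pow _ (adjMatrix_isHermitian G),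
      ← Equiv.sum_comp e]
    simp [he]
  have hcu : ∑ i, μ i ^ 3 ≤ 6 * ((G.cliqueFinset 3).card : ℝ) := by
    refine le_trans (le_of_eq ?_) (aux_trace_cube G)
    rw [aux_trace_pow _ (adjMatrix_isHermitian G), ← Equiv.sum_comp e]
    simp [he]
  have hw3 : (3 : ℝ) ≤ (ω : ℝ) := by exact_mod_cast hω
  have hsw : 0 < √(ω : ℝ) := Real.sqrt_pos.2 (by linarith)
  have hbase : 0 < 10.06 * c * √(ω : ℝ) := by positivity
  have hm0 : (0 : ℝ) < m := lt_of_lt_of_le (Real.rpow_pos_of_pos hbase _) hedges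
  have hme : 10.06 * c * √(ω : ℝ) ≤ (m : ℝ) ^ ε := by
    have := Real.rpow_le_rpow (Real.rpow_nonneg hbase.le _) hedges hε.le
    rwa [← Real.rpow_mul hbase.le, one_div, inv_mul_cancel₀ hε.ne', Real.rpow_one] at this
  set t : ℝ := ((G.cliqueFinset 3).card : ℝ)
  have hmm : (m : ℝ) ^ (1.5 - ε) * (m : ℝ) ^ ε = m * √m := by
    rw [← Real.rpow_add hm0, Real.sqrt_eq_rpow, ← Real.rpow_one_add' hm0.le (by norm_num)]
    norm_num
  have htt : 10.06 * (t * √(ω : ℝ)) ≤ m * √m := by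
    have hp : 0 < (m : ℝ) ^ (1.5 - ε) := Real.rpow_pos_of_pos hm0 _
    calc 10.06 * (t * √(ω : ℝ)) ≤ 10.06 * ((c * (m : ℝ) ^ (1.5 - ε)) * √(ω : ℝ)) := by gcongr
      _ = (m : ℝ) ^ (1.5 - ε) * (10.06 * c * √(ω : ℝ)) := by ring
      _ ≤ (m : ℝ) ^ (1.5 - ε) * (m : ℝ) ^ ε := by gcongr
      _ = _ := hmm
  set S := Finset.univ.filter
        (fun i : Fin (Fintype.card V) =>
          (i : ℕ) < min ((Finset.univ.filter fun j => 0 < μ j).card) ω) with hS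
  have hpos : ∀ i ∈ S, 0 < μ i := by
    intro i hi
    by_contra hneg
    have hi' : (i : ℕ) < (Finset.univ.filter fun j => 0 < μ j).card := by
      have := (Finset.mem_filter.1 hi).2
      omega
    have hsub : (Finset.univ.filter fun j => 0 < μ j) ⊆ Finset.Iio i := by
      intro j hj
      rw [Finset.mem_Iio]
      by_contra hij
      exact hneg (lt_of_lt_of_le (Finset.mem_filter.1 hj).2 (hanti (not_lt.1 hij)))
    have := Finset.card_le_card hsub
    rw [Fin.card_Iio] at this
    omega
  have hcard : S.card ≤ ω := by
    have : (S.image (fun i : Fin (Fintype.card V) => (i : ℕ))) ⊆ Finset.range ω := by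
      intro k hk
      obtain ⟨i, hi, rfl⟩ := Finset.mem_image.1 hk
      have := (Finset.mem_filter.1 hi).2
      rw [Finset.mem_range]
      omega
    have := Finset.card_le_card this
    rwa [Finset.card_image_of_injective _ Fin.val_injective, Finset.card_range] at this
  have hs2 := Finset.sum_add_sum_compl S (fun i => μ i ^ 2)
  have hs3 := Finset.sum_add_sum_compl S (fun i => μ i ^ 3)
  refine aux_core m ω _ (∑ i ∈ Sᶜ, μ i ^ 2) (∑ i ∈ S, μ i ^ 3) (∑ i ∈ Sᶜ, μ i ^ 3) t hm0 hw3
    (hs2.trans hsq) (Finset.sum_nonneg fun i _ => sq_nonneg _)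
    (Finset.sum_nonneg fun i hi => (pow_pos (hpos i hi) 3).le)
    (aux_pos_cubes S μ hpos _ (by exact_mod_cast hcard)) (aux_rest _ _)
    (hs3.trans_le hcu) htt
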